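/- arXiv:1106.4474 — 2 statements merged into one kernel-verified Lean document; each statement's English description precedes it below -/
import Mathlib

section
/- Let α : C → A be any homomorphism of k-algebras. Then A is flat as a C-module via α (equivalently, since C is a local ring, A is free as a C-module via α) if and only if the images of α(t₁), …, α(t_r) in Rad(A)/Rad²(A) are linearly independent over k. (Each α(t_i) satisfies α(t_i)ᵖ = 0, hence lies in Rad(A), so its image in Rad(A)/Rad²(A) makes sense.) -/
set_option synthInstance.maxHeartbeats 1000000
set_option maxHeartbeats 1000000

noncomputable section

def truncIdeal (k : Type*) [Field k] (n p : ℕ) : Ideal (MvPolynomial (Fin n) k) :=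
  Ideal.span (Set.range fun i : Fin n => (MvPolynomial.X i : MvPolynomial (Fin n) k) ^ p)

abbrev TruncAlg (k : Type*) [Field k] (n p : ℕ) :=
  MvPolynomial (Fin n) k ⧸ truncIdeal k n p

def xGen (k : Type*) [Field k] (n p : ℕ) (i : Fin n) : TruncAlg k n p :=
  Ideal.Quotient.mk (truncIdeal k n p) (MvPolynomial.X i)

def radIdeal (k : Type*) [Field k] (n p : ℕ) : Ideal (TruncAlg k n p) :=
  Ideal.span (Set.range (xGen k n p))

def IsFreeVia {C A : Type*} [CommRing C] [CommRing A] (α : C →+* A)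
    (M : Type*) [AddCommGroup M] [Module A M] : Prop :=
  letI : Module C M := Module.compHom M α
  Module.Free C M

/-- The annihilator of `t` is generated by `t ^ (p - 1)`. When `t ^ p = 0`, this is the
exactness of the periodic complex given by multiplication by `t` and `t ^ (p - 1)`. -/
def AnnEqPow {R : Type*} [CommRing R] (p : ℕ) (t : R) : Prop :=
  ∀ a, t * a = 0 → ∃ b, a = t ^ (p - 1) * b

theorem geom_sum₂_eq_sub_pow_of_charP {R : Type*} [CommRing R] (p : ℕ) [Fact p.Prime] [CharP R p]
    (x y : R) : ∑ i ∈ Finset.range p, x ^ i * y ^ (p - 1 - i) = (x - y) ^ (p - 1) := by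
  have hp : p ≠ 0 := (Fact.out : p.Prime).ne_zero
  have key : ∑ i ∈ Finset.range p, (MvPolynomial.X 0 : MvPolynomial (Fin 2) (ZMod p)) ^ i *
      MvPolynomial.X 1 ^ (p - 1 - i) = (MvPolynomial.X 0 - MvPolynomial.X 1) ^ (p - 1) := by
    have hne : (MvPolynomial.X 0 - MvPolynomial.X 1 : MvPolynomial (Fin 2) (ZMod p)) ≠ 0 :=
      sub_ne_zero.2 fun h => by simpa using MvPolynomial.X_injective h
    apply mul_right_cancel₀ hne
    rw [← pow_succ, Nat.sub_add_cancel (Nat.one_le_iff_ne_zero.2 hp), sub_pow_char,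
      (Commute.all _ _).geom_sum₂_mul]
  simpa using congrArg (MvPolynomial.eval₂Hom (ZMod.castHom dvd_rfl R) ![x, y]) key

open Polynomial in
theorem AnnEqPow.exists_dvd_sub {R : Type*} [CommRing R] {p : ℕ} [Fact p.Prime] [CharP R p]
    {t b : R} (ht : AnnEqPow p t) (htp : t ^ p = 0) (hb : b ^ p = 0) (j : ℕ) (f : R[X])
    (hf : X ^ j ∣ (C t + C b * X) * f) :
    ∃ g, X ^ j ∣ f - (C t + C b * X) ^ (p - 1) * g := by
  have hp : p ≠ 0 := (Fact.out : p.Prime).ne_zero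
  have hD : (C t + C b * X) ^ p = 0 := by
    rw [add_pow_char, mul_pow, ← C_pow, ← C_pow, htp, hb]; simp
  induction j generalizing f with
  | zero => exact ⟨0, by simp⟩
  | succ j ih =>
    have h0 : t * f.coeff 0 = 0 := by
      have := (X_pow_dvd_iff.1 hf) 0 (Nat.succ_pos j)
      simpa [mul_coeff_zero] using this
    obtain ⟨b₀, hb₀⟩ := ht _ h0
    have hX : X ∣ f - (C t + C b * X) ^ (p - 1) * C b₀ := by
      rw [X_dvd_iff, coeff_sub, mul_coeff_zero, hb₀]
      simp [coeff_zero_eq_eval_zero]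
    obtain ⟨f', hf'⟩ := hX
    have h1 : X ^ j ∣ (C t + C b * X) * f' := by
      have : X ^ (j + 1) ∣ X * ((C t + C b * X) * f') := by
        have e : X * ((C t + C b * X) * f') = (C t + C b * X) * f - (C t + C b * X) ^ p * C b₀ := by
          rw [show X * ((C t + C b * X) * f') = (C t + C b * X) * (X * f') by ring, ← hf',
            ← pow_sub_one_mul hp (C t + C b * X)]
          ring
        rw [e, hD]
        simpa using hf
      rw [pow_succ', X_mul, X_mul, mul_comm _ X, mul_comm _ X] at this
      have hc := (isRegular_X (R := R)).left
      obtain ⟨q, hq⟩ := this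
      exact ⟨q, hc (by simpa [mul_assoc] using hq)⟩
    obtain ⟨g, q, hg⟩ := ih f' h1
    refine ⟨C b₀ + X * g, q, ?_⟩
    linear_combination hf' + X * hg

open Polynomial in
theorem annEqPow_of_exists_dvd_sub {R : Type*} [CommRing R] {p : ℕ} [Fact p.Prime] [CharP R p]
    {a b : R} (hb : b ^ p = 0)
    (h : ∀ f : R[X], X ^ p ∣ (C a + C b * X) * f →
      ∃ g, X ^ p ∣ f - (C a + C b * X) ^ (p - 1) * g) : AnnEqPow p a := by
  have hp2 : 2 ≤ p := (Fact.out : p.Prime).two_le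
  obtain ⟨m, rfl⟩ : ∃ m, p = m + 2 := ⟨p - 2, by omega⟩
  simp only [show m + 2 - 1 = m + 1 by omega] at h
  have step : ∀ x, a * x = 0 → ∃ c q, a * q = 0 ∧ x = a ^ (m + 1) * c + b * q := by
    intro x hx
    have hx' : (C a : R[X]) * C x = 0 := by rw [← C_mul, hx, C_0]
    obtain ⟨g, hg⟩ := h (C x * X ^ (m + 1)) ⟨C b * C x, by linear_combination X ^ (m + 1) * hx'⟩
    set D : R[X] := C a + C b * X with hD
    set Q : R[X] := ∑ i ∈ Finset.range (m + 1), D ^ i * C a ^ (m - i) with hQ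
    have e1 : D ^ (m + 1) = C a ^ (m + 1) + C b * X * Q := by
      have := (Commute.all D (C a)).geom_sum₂_mul (m + 1)
      rw [show m + 1 - 1 = m by omega, ← hQ] at this
      linear_combination -this + Q * hD
    have e2 : C a * Q = (C b * X) ^ (m + 1) - D ^ (m + 1) := by
      have := geom_sum₂_eq_sub_pow_of_charP (m + 2) D (C a)
      rw [Finset.sum_range_succ, show m + 2 - 1 = m + 1 by omega, show D - C a = C b * X by
        rw [hD]; ring] at this
      rw [← this, hQ, Finset.mul_sum, Nat.sub_self, pow_zero, mul_one, add_sub_cancel_right]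
      refine Finset.sum_congr rfl fun i hi => ?_
      rw [show m + 1 - i = (m - i) + 1 by have := Finset.mem_range.1 hi; omega]
      ring
    have hc := X_pow_dvd_iff.1 hg
    refine ⟨g.coeff (m + 1), (Q * g).coeff m, ?_, ?_⟩
    · have hm := hc m (by omega)
      rw [coeff_sub, coeff_C_mul, coeff_X_pow, if_neg (by omega), mul_zero, zero_sub,
        neg_eq_zero] at hm
      rw [← coeff_C_mul, ← mul_assoc, e2, sub_mul, coeff_sub, hm, sub_zero, mul_pow,
        mul_right_comm, coeff_mul_X_pow', if_neg (by omega)]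
    · have hm := hc (m + 1) (by omega)
      rw [coeff_sub, coeff_C_mul, coeff_X_pow, if_pos rfl, mul_one, e1, add_mul, coeff_add,
        ← C_pow, coeff_C_mul, show C b * X * Q * g = C b * (Q * g * X) by ring, coeff_C_mul,
        coeff_mul_X] at hm
      linear_combination hm
  have iter : ∀ j x, a * x = 0 → ∃ c q, a * q = 0 ∧ x = a ^ (m + 1) * c + b ^ j * q := by
    intro j
    induction j with
    | zero => exact fun x hx => ⟨0, x, hx, by simp⟩
    | succ j ih =>
      intro x hx
      obtain ⟨c, q, hq, rfl⟩ := ih x hx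
      obtain ⟨c', q', hq', rfl⟩ := step q hq
      exact ⟨c + b ^ j * c', q', hq', by ring⟩
  intro x hx
  obtain ⟨c, q, -, rfl⟩ := iter (m + 2) x hx
  exact ⟨c, by rw [hb]; simp⟩

open Polynomial in
/-- Exactness of multiplication by `a` is insensitive to adding a product of two elements whose
`p`-th powers vanish. -/
theorem AnnEqPow.of_add_mul {R : Type*} [CommRing R] {p : ℕ} [Fact p.Prime] [CharP R p]
    {a b c : R} (ha : a ^ p = 0) (hb : b ^ p = 0) (hc : c ^ p = 0)
    (h : AnnEqPow p (a + b * c)) : AnnEqPow p a := by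
  refine annEqPow_of_exists_dvd_sub hb fun f hf => ?_
  have hX : ∀ c : R, c ^ p = 0 → (X + C c : R[X]) ^ p = X ^ p := fun c hc => by
    rw [add_pow_char, ← C_pow, hc, C_0, add_zero]
  have hf' := map_dvd (compRingHom (X + C c)) hf
  simp only [coe_compRingHom_apply, mul_comp, pow_comp, X_comp, add_comp, C_comp, hX c hc] at hf'
  rw [show C a + C b * (X + C c) = C (a + b * c) + C b * X by rw [C_add, C_mul]; ring] at hf'
  obtain ⟨g, hg⟩ := h.exists_dvd_sub (by rw [add_pow_char, mul_pow, ha, hb]; simp) hb p _ hf'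
  refine ⟨g.comp (X + C (-c)), ?_⟩
  have hg' := map_dvd (compRingHom (X + C (-c))) hg
  simp only [coe_compRingHom_apply, mul_comp, pow_comp, X_comp, add_comp, C_comp, sub_comp,
    hX (-c) (by rw [neg_pow, hc, mul_zero]), comp_assoc] at hg'
  convert hg' using 2
  · simp
  · congr 2
    simp only [C_add, C_mul, C_neg]; ring

/-- An element of the square of an ideal with vanishing `p`-th powers never satisfies `AnnEqPow`. -/
theorem not_annEqPow_of_mem_sq {R : Type*} [CommRing R] [Nontrivial R] {p : ℕ} [Fact p.Prime]
    [CharP R p] {I : Ideal R} (hI : ∀ x ∈ I, x ^ p = 0) {v : R} (hv : v ∈ I ^ 2) :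
    ¬ AnnEqPow p v := by
  have key : ∀ a ∈ I, AnnEqPow p (a + v) → AnnEqPow p a := by
    rw [pow_two] at hv
    induction hv using Submodule.mul_induction_on' with
    | mem_mul_mem x hx y hy => exact fun a ha h => h.of_add_mul (hI a ha) (hI x hx) (hI y hy)
    | add x hx y hy ihx ihy =>
      exact fun a ha h => ihx a ha (ihy _ (add_mem ha (Ideal.mul_le_left hx)) (by rwa [add_assoc]))
  intro h
  obtain ⟨b, hb⟩ := key 0 I.zero_mem (by rwa [zero_add]) 1 (zero_mul 1)
  rw [zero_pow (Nat.sub_ne_zero_of_lt (Fact.out : p.Prime).one_lt), zero_mul] at hb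
  exact one_ne_zero hb

theorem AnnEqPow.exists_eq_smul_of_free {R M : Type*} [CommRing R] [AddCommGroup M] [Module R M]
    [Module.Free R M] {p : ℕ} {s : R} (hs : AnnEqPow p s) {x : M} (hx : s • x = 0) :
    ∃ y : M, x = s ^ (p - 1) • y := by
  classical
  let B := Module.Free.chooseBasis R M
  have h : ∀ c : R, ∃ d, (s * c = 0 → c = s ^ (p - 1) * d) ∧ (c = 0 → d = 0) := by
    intro c
    by_cases hc0 : c = 0
    · exact ⟨0, by simp [hc0], fun _ => rfl⟩
    · by_cases hc : s * c = 0
      · obtain ⟨d, hd⟩ := hs c hc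
        exact ⟨d, fun _ => hd, fun h => absurd h hc0⟩
      · exact ⟨0, fun h => absurd h hc, fun _ => rfl⟩
  choose d hd hd0 using h
  refine ⟨B.repr.symm ((B.repr x).mapRange d (hd0 0 rfl)), ?_⟩
  apply B.repr.injective
  ext i
  have hi : s * B.repr x i = 0 := by simpa using congrArg (fun z => B.repr z i) hx
  simpa using hd _ hi

theorem span_prod_pow_eq_top {R A ι : Type*} [CommRing R] [CommRing A] [Algebra R A] [Fintype ι]
    {p : ℕ} {z : ι → A} (hz : ∀ i, z i ^ p = 0) (h : Algebra.adjoin R (Set.range z) = ⊤) :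
    Submodule.span R (Set.range fun b : ι → Fin p => ∏ i, z i ^ (b i : ℕ)) = ⊤ := by
  rw [← Algebra.top_toSubmodule, ← h, Algebra.adjoin_eq_span]
  refine le_antisymm (Submodule.span_mono ?_) (Submodule.span_le.2 ?_)
  · rintro _ ⟨b, rfl⟩
    exact Submonoid.mem_closure_range_iff_of_fintype.2 ⟨fun i => b i, rfl⟩
  · intro x hx
    obtain ⟨a, rfl⟩ := Submonoid.mem_closure_range_iff_of_fintype.1 hx
    by_cases ha : ∀ i, a i < p
    · exact Submodule.subset_span ⟨fun i => ⟨a i, ha i⟩, rfl⟩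
    · push Not at ha
      obtain ⟨i, hi⟩ := ha
      rw [Finset.prod_eq_zero (Finset.mem_univ i) (show z i ^ a i = 0 from
        pow_eq_zero_of_le hi (hz i))]
      exact zero_mem _

theorem free_of_adjoin_eq_top (k : Type*) {C A ι : Type*} [Field k] [CommRing C] [CommRing A]
    [Algebra k C] [Algebra k A] [Algebra C A] [IsScalarTower k C A] [Fintype ι]
    [FiniteDimensional k C] {p : ℕ} {z : ι → A} (hz : ∀ i, z i ^ p = 0)
    (h : Algebra.adjoin C (Set.range z) = ⊤)
    (hd : Module.finrank k C * p ^ Fintype.card ι ≤ Module.finrank k A) : Module.Free C A := by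
  classical
  have hs := span_prod_pow_eq_top hz h
  let φ : ((ι → Fin p) → C) →ₗ[C] A := Fintype.linearCombination C
    fun b : ι → Fin p => ∏ i, z i ^ (b i : ℕ)
  have hφ : Function.Surjective φ := by
    rw [← LinearMap.range_eq_top, ← hs, Fintype.range_linearCombination]
  let ψ := φ.restrictScalars k
  have hψ : Function.Surjective ψ := hφ
  have : FiniteDimensional k A := Module.Finite.of_surjective ψ hψ
  have hle := LinearMap.finrank_le_finrank_of_surjective hψ
  have hdim : Module.finrank k ((ι → Fin p) → C) = Module.finrank k A := by
    apply le_antisymm _ hle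
    rw [Module.finrank_pi_fintype]
    simpa [mul_comm] using hd
  have hinj : Function.Injective ψ :=
    (LinearMap.injective_iff_surjective_of_finrank_eq_finrank hdim).2 hψ
  exact Module.Free.of_equiv (LinearEquiv.ofBijective φ ⟨hinj, hφ⟩)

theorem adjoin_eq_top_of_span_eq {k C A σ : Type*} [CommRing k] [CommRing C] [CommRing A]
    [Algebra k C] [Algebra k A] [Algebra C A] [IsScalarTower k C A] [Fintype σ] {I : Ideal A}
    (hI : IsNilpotent I) (hk : ∀ a : A, ∃ c : k, a - algebraMap k A c ∈ I) (S : Subalgebra C A)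
    {w : σ → A} (hw : ∀ i, w i ∈ S) (hwI : Ideal.span (Set.range w) = I) : S = ⊤ := by
  have key : ∀ m : ℕ, ∀ a : A, ∃ b ∈ S, a - b ∈ I ^ m := by
    intro m
    induction m with
    | zero => exact fun a => ⟨0, S.zero_mem, by simp⟩
    | succ m ih =>
      intro a
      obtain ⟨c, hc⟩ := hk a
      rw [← hwI] at hc
      obtain ⟨u, hu⟩ := Ideal.mem_span_range_iff_exists_fun.1 hc
      choose b hb hbI using ih
      refine ⟨algebraMap k A c + ∑ i, b (u i) * w i, add_mem ?_
        (sum_mem fun i _ => mul_mem (hb _) (hw i)), ?_⟩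
      · rw [IsScalarTower.algebraMap_apply k C A]
        exact S.algebraMap_mem _
      · rw [← sub_sub, ← hu, ← Finset.sum_sub_distrib]
        refine sum_mem fun i _ => ?_
        rw [← sub_mul, pow_succ]
        exact Ideal.mul_mem_mul (hbI _) (hwI ▸ Ideal.subset_span ⟨i, rfl⟩)
  obtain ⟨m, hm⟩ := hI
  refine eq_top_iff.2 fun a _ => ?_
  obtain ⟨b, hb, hab⟩ := key m a
  rw [hm, Ideal.zero_eq_bot, Ideal.mem_bot, sub_eq_zero] at hab
  exact hab ▸ hb

section TruncAlg

variable {k : Type*} [Field k] {n p : ℕ}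

theorem xGen_pow (i : Fin n) : xGen k n p i ^ p = 0 := by
  rw [xGen, ← map_pow, Ideal.Quotient.eq_zero_iff_mem]
  exact Ideal.subset_span ⟨i, rfl⟩

theorem adjoin_range_xGen : Algebra.adjoin k (Set.range (xGen k n p)) = ⊤ := by
  have h := congrArg (Subalgebra.map (Ideal.Quotient.mkₐ k (truncIdeal k n p)))
    (MvPolynomial.adjoin_range_X (R := k) (σ := Fin n))
  rw [AlgHom.map_adjoin, ← Set.range_comp, Algebra.map_top,
    (AlgHom.range_eq_top _).2 (Ideal.Quotient.mkₐ_surjective k _)] at h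
  exact h

instance finiteDimensional_truncAlg : FiniteDimensional k (TruncAlg k n p) := by
  have := span_prod_pow_eq_top (R := k) xGen_pow (adjoin_range_xGen (k := k) (n := n) (p := p))
  exact ⟨this ▸ Submodule.fg_span (Set.finite_range _)⟩

theorem finrank_truncAlg : Module.finrank k (TruncAlg k n p) = p ^ n := by
  have hs := span_prod_pow_eq_top (R := k) xGen_pow (adjoin_range_xGen (k := k) (n := n) (p := p))
  have hli : LinearIndependent k
      fun b : Fin n → Fin p => ∏ i, xGen k n p i ^ (b i : ℕ) := by
    rw [Fintype.linearIndependent_iff]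
    intro g hg b
    let e : (Fin n → Fin p) → (Fin n →₀ ℕ) := fun b => Finsupp.equivFunOnFinite.symm fun i => b i
    have he : Function.Injective e := fun b c h => by
      ext i
      simpa [e] using DFunLike.congr_fun h i
    let f : MvPolynomial (Fin n) k := ∑ b, MvPolynomial.monomial (e b) (g b)
    have hf : f ∈ truncIdeal k n p := by
      rw [← Ideal.Quotient.eq_zero_iff_mem, ← hg, map_sum]
      refine Finset.sum_congr rfl fun b _ => ?_
      rw [MvPolynomial.monomial_eq, Finsupp.prod_fintype _ _ (by simp), map_mul, map_prod]
      have hsmul (c : k) (a : TruncAlg k n p) : c • a = algebraMap k (TruncAlg k n p) c * a :=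
        Algebra.smul_def c a
      rw [hsmul]
      simp only [map_pow]
      rfl
    have hfc : ∀ b, f.coeff (e b) = g b := fun b => by
      classical
      simp [f, MvPolynomial.coeff_sum, MvPolynomial.coeff_monomial, he.eq_iff]
    have hI : truncIdeal k n p = Ideal.span ((fun s => MvPolynomial.monomial s (1 : k)) ''
        Set.range fun i : Fin n => Finsupp.single i p) := by
      rw [truncIdeal, ← Set.range_comp]
      simp only [Function.comp_def, MvPolynomial.X_pow_eq_monomial]
    rw [hI, MvPolynomial.mem_ideal_span_monomial_image] at hf
    by_contra hb
    obtain ⟨_, ⟨i, rfl⟩, hi⟩ := hf (e b) (by rwa [MvPolynomial.mem_support_iff, hfc])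
    have := hi i
    simp only [Finsupp.single_eq_same, e, Finsupp.equivFunOnFinite_symm_apply_apply] at this
    exact absurd (b i).2 (not_lt.2 this)
  have := Module.finrank_eq_card_basis (Module.Basis.mk hli hs.ge)
  simpa using this

/-- The `k`-algebra homomorphism out of the truncated polynomial algebra determined by the images
of the generators. -/
def truncLift {A : Type*} [CommRing A] [Algebra k A] (y : Fin n → A) (hy : ∀ i, y i ^ p = 0) :
    TruncAlg k n p →ₐ[k] A :=
  Ideal.Quotient.liftₐ (truncIdeal k n p) (MvPolynomial.aeval y) fun a ha => by
    have : truncIdeal k n p ≤ RingHom.ker (MvPolynomial.aeval (R := k) y) := by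
      rw [truncIdeal, Ideal.span_le]
      rintro _ ⟨i, rfl⟩
      simp [RingHom.mem_ker, hy]
    exact this ha

@[simp]
theorem truncLift_xGen {A : Type*} [CommRing A] [Algebra k A] (y : Fin n → A)
    (hy : ∀ i, y i ^ p = 0) (i : Fin n) : truncLift (k := k) y hy (xGen k n p i) = y i := by
  exact MvPolynomial.aeval_X y i

theorem exists_sub_algebraMap_mem_radIdeal (a : TruncAlg k n p) :
    ∃ c : k, a - algebraMap k _ c ∈ radIdeal k n p := by
  have ha : a ∈ Algebra.adjoin k (Set.range (xGen k n p)) := by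
    rw [adjoin_range_xGen]; trivial
  induction ha using Algebra.adjoin_induction with
  | mem x hx => exact ⟨0, by simpa [radIdeal] using Ideal.subset_span hx⟩
  | algebraMap r => exact ⟨r, by simp⟩
  | add x y _ _ hx hy =>
    obtain ⟨c, hc⟩ := hx
    obtain ⟨d, hd⟩ := hy
    refine ⟨c + d, ?_⟩
    rw [map_add, add_sub_add_comm]
    exact add_mem hc hd
  | mul x y _ _ hx hy =>
    obtain ⟨c, hc⟩ := hx
    obtain ⟨d, hd⟩ := hy
    refine ⟨c * d, ?_⟩
    rw [map_mul, show x * y - algebraMap k _ c * algebraMap k _ d =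
      x * (y - algebraMap k _ d) + algebraMap k _ d * (x - algebraMap k _ c) by ring]
    exact add_mem (Ideal.mul_mem_left _ _ hd) (Ideal.mul_mem_left _ _ hc)

variable [Fact p.Prime]

instance nontrivial_truncAlg : Nontrivial (TruncAlg k n p) :=
  Module.nontrivial_of_finrank_pos (R := k)
    (finrank_truncAlg (k := k) ▸ pow_pos (Fact.out : p.Prime).pos n)

theorem linearIndependent_mkQ_xGen : LinearIndependent k fun i : Fin n =>
    Submodule.mkQ (Submodule.restrictScalars k ((radIdeal k n p) ^ 2)) (xGen k n p i) := by
  rw [Fintype.linearIndependent_iff]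
  intro g hg j
  classical
  let φ : TruncAlg k n p →ₐ[k] DualNumber k :=
    truncLift (Pi.single j DualNumber.eps) fun i => by
      have h2 : (DualNumber.eps : DualNumber k) ^ p = 0 :=
        pow_eq_zero_of_le (Fact.out : p.Prime).two_le (by rw [pow_two, DualNumber.eps_mul_eps])
      by_cases h : i = j
      · subst h; simpa using h2
      · simp [h, (Fact.out : p.Prime).ne_zero]
  have h1 : (radIdeal k n p).map φ.toRingHom ≤ Ideal.span {DualNumber.eps} := by
    rw [radIdeal, Ideal.map_span, Ideal.span_le]
    rintro _ ⟨_, ⟨i, rfl⟩, rfl⟩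
    have : φ (xGen k n p i) = Pi.single (M := fun _ => DualNumber k) j DualNumber.eps i :=
      truncLift_xGen _ _ _
    change φ (xGen k n p i) ∈ Ideal.span {DualNumber.eps}
    rw [this]
    by_cases h : i = j
    · subst h; simp
    · simp [h]
  have h2 : ((radIdeal k n p) ^ 2).map φ.toRingHom = ⊥ := by
    rw [Ideal.map_pow, eq_bot_iff]
    refine (Ideal.pow_right_mono h1 2).trans ?_
    rw [Ideal.span_singleton_pow, pow_two, DualNumber.eps_mul_eps]
    simp
  have hg' : ∑ i, g i • xGen k n p i ∈ (radIdeal k n p) ^ 2 := by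
    rw [← Submodule.restrictScalars_mem k, ← Submodule.Quotient.mk_eq_zero,
      ← Submodule.mkQ_apply, map_sum]
    simpa only [map_smul] using hg
  have h3 : φ (∑ i, g i • xGen k n p i) = 0 := by
    rw [← Ideal.mem_bot, ← h2]
    exact Ideal.mem_map_of_mem φ.toRingHom hg'
  have h4 : ∀ i, φ (xGen k n p i) = Pi.single (M := fun _ => DualNumber k) j DualNumber.eps i :=
    fun i => truncLift_xGen _ _ _
  simp only [map_sum, map_smul, h4, Pi.single_apply] at h3
  simpa using congrArg TrivSqZeroExt.snd h3

variable [CharP k p]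

instance charP_truncAlg : CharP (TruncAlg k n p) p :=
  charP_of_injective_algebraMap (algebraMap k _).injective p

theorem pow_eq_zero_of_mem_radIdeal {a : TruncAlg k n p} (ha : a ∈ radIdeal k n p) :
    a ^ p = 0 := by
  have hp : p ≠ 0 := (Fact.out : p.Prime).ne_zero
  induction ha using Submodule.span_induction with
  | mem x hx =>
    obtain ⟨i, rfl⟩ := hx
    exact xGen_pow i
  | zero => exact zero_pow hp
  | add x y _ _ hx hy => rw [add_pow_char, hx, hy, add_zero]
  | smul r x _ hx => rw [smul_eq_mul, mul_pow, hx, mul_zero]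

theorem mem_radIdeal_of_pow_eq_zero {a : TruncAlg k n p} (ha : a ^ p = 0) :
    a ∈ radIdeal k n p := by
  obtain ⟨c, hc⟩ := exists_sub_algebraMap_mem_radIdeal a
  have h := pow_eq_zero_of_mem_radIdeal hc
  rw [sub_pow_char, ha, zero_sub, neg_eq_zero, ← map_pow,
    map_eq_zero_iff _ (algebraMap k (TruncAlg k n p)).injective] at h
  simpa [pow_eq_zero_iff (Fact.out : p.Prime).ne_zero |>.1 h] using hc

theorem isNilpotent_radIdeal : IsNilpotent (radIdeal k n p) :=
  (Ideal.FG.isNilpotent_iff_le_nilradical (Submodule.fg_span (Set.finite_range _))).2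
    fun _ hx => ⟨p, pow_eq_zero_of_mem_radIdeal hx⟩

end TruncAlg

/-- Elements of a nilpotent ideal `I` which are linearly independent modulo `I ^ 2` can be completed
by some of the elements of a generating family to a generating family that is no larger. -/
theorem exists_span_sumElim_eq {k A ι σ : Type*} [Field k] [CommRing A] [Algebra k A] [Fintype ι]
    [Fintype σ] {I : Ideal A} (hI : IsNilpotent I) (hk : ∀ a : A, ∃ c : k, a - algebraMap k A c ∈ I)
    {x : σ → A} (hx : Ideal.span (Set.range x) = I) {y : ι → A} (hy : ∀ i, y i ∈ I)
    (hli : LinearIndependent k fun i => Submodule.mkQ (Submodule.restrictScalars k (I ^ 2)) (y i)) :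
    ∃ J : Finset σ, Fintype.card ι + J.card ≤ Fintype.card σ ∧
      Ideal.span (Set.range (Sum.elim y fun j : J => x j)) = I := by
  classical
  set π := Submodule.mkQ (Submodule.restrictScalars k (I ^ 2)) with hπ
  have hπ0 : ∀ a ∈ I ^ 2, π a = 0 := fun a ha => by
    rw [hπ, Submodule.mkQ_apply, Submodule.Quotient.mk_eq_zero]; exact ha
  have hxI : ∀ j, x j ∈ I := fun j => hx ▸ Ideal.subset_span ⟨j, rfl⟩
  have hW : ∀ a ∈ I, π a ∈ Submodule.span k (Set.range (π ∘ x)) := by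
    intro a ha
    rw [← hx] at ha
    obtain ⟨u, rfl⟩ := Ideal.mem_span_range_iff_exists_fun.1 ha
    rw [map_sum]
    refine sum_mem fun j _ => ?_
    obtain ⟨c, hc⟩ := hk (u j)
    have h0 : π ((u j - algebraMap k A c) * x j) = 0 :=
      hπ0 _ (pow_two I ▸ Ideal.mul_mem_mul hc (hxI j))
    have h1 : π (u j * x j) = c • π (x j) := by
      rw [← map_smul, Algebra.smul_def, ← sub_eq_zero, ← map_sub, ← sub_mul, h0]
    rw [h1]
    exact Submodule.smul_mem _ _ (Submodule.subset_span ⟨j, rfl⟩)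
  let v : ι ⊕ σ → A := Sum.elim y x
  have hs : LinearIndepOn k (π ∘ v) (Set.range Sum.inl) := by
    rw [linearIndepOn_range_iff Sum.inl_injective]
    exact hli
  obtain ⟨b, -, hsb, hspan, hb⟩ := exists_linearIndepOn_extension hs (Set.subset_univ _)
  let J : Finset σ := Finset.univ.filter fun j => Sum.inr j ∈ b
  have hJ : ∀ j ∈ J, Sum.inr j ∈ b := fun j hj => (Finset.mem_filter.1 hj).2
  let w : ι ⊕ J → A := Sum.elim y fun j : J => x j
  refine ⟨J, ?_, ?_⟩
  · let e : ι ⊕ J → b := Sum.elim (fun i => ⟨Sum.inl i, hsb ⟨i, rfl⟩⟩)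
      fun j => ⟨Sum.inr j, hJ j j.2⟩
    have he : Function.Injective e := by
      rintro (i | i) (j | j) h
      · exact congrArg Sum.inl (Sum.inl_injective (congrArg Subtype.val h))
      · exact absurd (congrArg Subtype.val h) Sum.inl_ne_inr
      · exact absurd (congrArg Subtype.val h) Sum.inr_ne_inl
      · exact congrArg Sum.inr (Subtype.ext (Sum.inr_injective (congrArg Subtype.val h)))
    have hew : ∀ s, π (v (e s)) = π (w s) := by rintro (i | j) <;> rfl
    have hw : LinearIndependent k (π ∘ w) := by
      have := LinearIndependent.comp hb e he
      rwa [show (fun x : b => (π ∘ v) x) ∘ e = π ∘ w from funext hew] at this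
    have h1 := finrank_span_eq_card hw
    have h2 : Submodule.span k (Set.range (π ∘ w)) ≤ Submodule.span k (Set.range (π ∘ x)) := by
      rw [Submodule.span_le]
      rintro _ ⟨i | j, rfl⟩
      · exact hW _ (hy i)
      · exact hW _ (hxI j)
    have : FiniteDimensional k (Submodule.span k (Set.range (π ∘ x))) :=
      FiniteDimensional.span_of_finite k (Set.finite_range _)
    have h3 := (Submodule.finrank_mono h2).trans (finrank_range_le_card (π ∘ x))
    rw [h1] at h3
    simpa using h3
  · change Ideal.span (Set.range w) = I
    apply le_antisymm
    · rw [Ideal.span_le]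
      rintro _ ⟨i | j, rfl⟩
      · exact hy i
      · exact hxI j
    have hjac : I ≤ Ideal.jacobson ⊥ := fun a ha => by
      obtain ⟨m, hm⟩ := hI
      have : IsNilpotent a := ⟨m, by simpa [hm] using Ideal.pow_mem_pow ha m⟩
      exact Ideal.radical_le_jacobson (mem_nilradical.2 this)
    refine Submodule.le_of_le_smul_of_le_jacobson_bot (hx ▸ Submodule.fg_span (Set.finite_range _))
      hjac ?_
    conv_lhs => rw [← hx]
    rw [Ideal.span_le]
    rintro _ ⟨j, rfl⟩
    have h1 : π (x j) ∈ Submodule.span k (π '' Set.range w) := by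
      refine Submodule.span_mono ?_ (hspan ⟨Sum.inr j, trivial, rfl⟩)
      rintro _ ⟨i | j, hj, rfl⟩
      · exact ⟨_, ⟨Sum.inl i, rfl⟩, rfl⟩
      · exact ⟨_, ⟨Sum.inr ⟨j, Finset.mem_filter.2 ⟨Finset.mem_univ _, hj⟩⟩, rfl⟩, rfl⟩
    rw [← Submodule.map_span] at h1
    obtain ⟨s, hs, hsx⟩ := h1
    have h2 : x j - s ∈ I ^ 2 := by
      have : π (x j - s) = 0 := by rw [map_sub, hsx, sub_self]
      rwa [hπ, Submodule.mkQ_apply, Submodule.Quotient.mk_eq_zero] at this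
    rw [← add_sub_cancel s (x j)]
    refine add_mem (Submodule.mem_sup_left (Submodule.span_le_restrictScalars k A _ hs))
      (Submodule.mem_sup_right ?_)
    rwa [smul_eq_mul, ← pow_two]

theorem linearIndependent_mkQ_iff {R M ι : Type*} [Ring R] [AddCommGroup M] [Module R M]
    [Fintype ι] {N : Submodule R M} {y : ι → M} :
    (LinearIndependent R fun i => N.mkQ (y i)) ↔
      ∀ c : ι → R, ∑ i, c i • y i ∈ N → ∀ i, c i = 0 := by
  have h (c : ι → R) : ∑ i, c i • N.mkQ (y i) = 0 ↔ ∑ i, c i • y i ∈ N := by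
    rw [← Submodule.Quotient.mk_eq_zero, ← Submodule.mkQ_apply, map_sum]
    simp only [map_smul]
  simp only [Fintype.linearIndependent_iff, h]

theorem annEqPow_xGen_zero {k : Type*} [Field k] {p : ℕ} [Fact p.Prime] :
    AnnEqPow p (xGen k 1 p 0) := by
  have hp : p ≠ 0 := (Fact.out : p.Prime).ne_zero
  intro a ha
  obtain ⟨f, rfl⟩ := Ideal.Quotient.mk_surjective a
  rw [xGen, ← map_mul, Ideal.Quotient.eq_zero_iff_mem, truncIdeal, Set.range_unique,
    Ideal.mem_span_singleton] at ha
  obtain ⟨h, hh⟩ := ha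
  refine ⟨Ideal.Quotient.mk _ h, ?_⟩
  rw [xGen, ← map_pow, ← map_mul]
  congr 1
  apply mul_left_cancel₀ (MvPolynomial.X_ne_zero (R := k) (0 : Fin 1))
  rw [hh, ← mul_assoc, mul_pow_sub_one hp]
  rfl

section TruncAlg

variable {k : Type*} [Field k] {n p : ℕ} [Fact p.Prime] [CharP k p]

theorem isFreeVia_of_linearIndependent {C : Type*} [CommRing C] [Algebra k C]
    [FiniteDimensional k C] {r : ℕ} (hC : Module.finrank k C ≤ p ^ r)
    (α : C →ₐ[k] TruncAlg k n p) {t : Fin r → C} (ht : ∀ i, t i ^ p = 0)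
    (hli : LinearIndependent k fun i =>
      Submodule.mkQ (Submodule.restrictScalars k ((radIdeal k n p) ^ 2)) (α (t i))) :
    IsFreeVia α.toRingHom (TruncAlg k n p) := by
  obtain ⟨J, hJ, hspan⟩ := exists_span_sumElim_eq isNilpotent_radIdeal
    exists_sub_algebraMap_mem_radIdeal (rfl : Ideal.span (Set.range (xGen k n p)) = _)
    (fun i => mem_radIdeal_of_pow_eq_zero (by rw [← map_pow, ht, map_zero])) hli
  let _ : Algebra C (TruncAlg k n p) := α.toRingHom.toAlgebra
  have : IsScalarTower k C (TruncAlg k n p) :=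
    IsScalarTower.of_algebraMap_eq fun c => (α.commutes c).symm
  have hadj : Algebra.adjoin C (Set.range fun j : J => xGen k n p j) = ⊤ := by
    refine adjoin_eq_top_of_span_eq (k := k) isNilpotent_radIdeal
      exists_sub_algebraMap_mem_radIdeal _ ?_ hspan
    rintro (i | j)
    · exact Subalgebra.algebraMap_mem _ (t i)
    · exact Algebra.subset_adjoin ⟨j, rfl⟩
  refine free_of_adjoin_eq_top k (p := p) (fun j => xGen_pow _) hadj ?_
  rw [finrank_truncAlg, Fintype.card_coe]
  simp only [Fintype.card_fin] at hJ
  calc Module.finrank k C * p ^ J.card ≤ p ^ r * p ^ J.card := Nat.mul_le_mul_right _ hC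
    _ = p ^ (r + J.card) := (pow_add _ _ _).symm
    _ ≤ p ^ n := Nat.pow_le_pow_right (Fact.out : p.Prime).pos hJ

theorem AnnEqPow.of_isFreeVia {C A : Type*} [CommRing C] [CommRing A] {α : C →+* A}
    (hα : IsFreeVia α A) {p : ℕ} {s : C} (hs : AnnEqPow p s) : AnnEqPow p (α s) := by
  let _ : Module C A := Module.compHom A α
  have : Module.Free C A := hα
  intro a ha
  obtain ⟨b, hb⟩ := hs.exists_eq_smul_of_free (x := a) ha
  refine ⟨b, hb.trans ?_⟩
  rw [← map_pow]
  rfl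

theorem annEqPow_sum_smul_xGen {c : Fin n → k} (hc : c ≠ 0) :
    AnnEqPow p (∑ i, c i • xGen k n p i) := by
  have hu : (∑ i, c i • xGen k n p i) ^ p = 0 :=
    pow_eq_zero_of_mem_radIdeal (sum_mem fun i _ =>
      Submodule.smul_of_tower_mem _ _ (Ideal.subset_span ⟨i, rfl⟩))
  let β : TruncAlg k 1 p →ₐ[k] TruncAlg k n p :=
    truncLift (fun _ => ∑ i, c i • xGen k n p i) fun _ => hu
  have hβ : β (xGen k 1 p 0) = ∑ i, c i • xGen k n p i := truncLift_xGen _ _ _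
  have hfree : IsFreeVia β.toRingHom (TruncAlg k n p) := by
    have hd : Module.finrank k (TruncAlg k 1 p) ≤ p ^ 1 := (finrank_truncAlg (k := k)).le
    refine isFreeVia_of_linearIndependent hd β (t := xGen k 1 p) (fun i => xGen_pow i) ?_
    rw [linearIndependent_unique_iff]
    change Submodule.mkQ _ (β (xGen k 1 p 0)) ≠ 0
    rw [hβ, Submodule.mkQ_apply, Ne, Submodule.Quotient.mk_eq_zero]
    exact fun h => hc (funext (linearIndependent_mkQ_iff.1 linearIndependent_mkQ_xGen c h))
  rw [← hβ]
  exact annEqPow_xGen_zero.of_isFreeVia hfree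

end TruncAlg

/-- A homomorphism `α : C → A` of `k`-algebras makes `A` a free (equivalently, flat)
`C`-module if and only if the images of `α(t₁), …, α(t_r)` in `Rad(A)/Rad²(A)` are
linearly independent over `k`. -/
theorem statement0 {k : Type*} [Field k] [IsAlgClosed k] (p n r : ℕ) [Fact p.Prime]
    [CharP k p] (α : TruncAlg k r p →ₐ[k] TruncAlg k n p) :
    IsFreeVia α.toRingHom (TruncAlg k n p) ↔
      LinearIndependent k fun i : Fin r =>
        Submodule.mkQ (Submodule.restrictScalars k
            ((radIdeal k n p) ^ 2 : Ideal (TruncAlg k n p)))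
          (α (xGen k r p i)) := by
  have hd : Module.finrank k (TruncAlg k r p) ≤ p ^ r := (finrank_truncAlg (k := k)).le
  refine ⟨fun h => ?_, isFreeVia_of_linearIndependent hd α fun i => xGen_pow i⟩
  rw [linearIndependent_mkQ_iff]
  intro c hc
  by_contra hne
  have hc0 : c ≠ 0 := fun h0 => hne fun i => congrFun h0 i
  refine not_annEqPow_of_mem_sq (fun x hx => pow_eq_zero_of_mem_radIdeal hx) ?_
    ((annEqPow_sum_smul_xGen hc0).of_isFreeVia h)
  have hα : α (∑ i, c i • xGen k r p i) = ∑ i, c i • α (xGen k r p i) := by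
    rw [map_sum]
    exact Finset.sum_congr rfl fun i _ => map_smul α (c i) (xGen k r p i)
  exact hα.symm ▸ hc

end
end

section
/- Let M and N be finite-dimensional A-modules, and let T be the A-module whose underlying k-vector space is M ⊗_k N and on which each generator x_i acts by x_i·(m ⊗ n) = (x_i·m) ⊗ n + m ⊗ (x_i·n) (this determines a well-defined A-module structure, since these operators pairwise commute and have vanishing p-th power). Then for every r-dimensional subspace U ⊆ V: if α_U^*(T) is not free as a C-module, then neither α_U^*(M) nor α_U^*(N) is free as a C-module. -/
open scoped TensorProduct

set_option synthInstance.maxHeartbeats 1000000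
set_option maxHeartbeats 1000000

noncomputable section

def xSpan (k : Type*) [Field k] (n p : ℕ) : Submodule k (TruncAlg k n p) :=
  Submodule.span k (Set.range (xGen k n p))

def smulLinear (k : Type*) {A : Type*} (M : Type*) [CommSemiring k] [Semiring A]
    [AddCommMonoid M] [Module k M] [Module A M] [SMulCommClass k A M] (a : A) :
    M →ₗ[k] M where
  toFun m := a • m
  map_add' x y := smul_add a x y
  map_smul' c m := (smul_comm c a m).symm

def radPow (k A M : Type*) [CommSemiring k] [CommRing A] [AddCommMonoid M]
    [Module k M] [Module A M] [SMulCommClass k A M] (U : Set A) (j : ℕ) :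
    Submodule k M :=
  ⨆ (u : Fin j → A) (_ : ∀ i, u i ∈ U), LinearMap.range (smulLinear k M (∏ i, u i))

def socPow (k A M : Type*) [CommSemiring k] [CommRing A] [AddCommMonoid M]
    [Module k M] [Module A M] [SMulCommClass k A M] (U : Set A) (j : ℕ) :
    Submodule k M :=
  ⨅ (u : Fin j → A) (_ : ∀ i, u i ∈ U), LinearMap.ker (smulLinear k M (∏ i, u i))

/-- `P_j`: the image in `T` of `M ⊗ Iʲ N`. -/
def tensorFiltration (k : Type*) {A M N T : Type*} [Field k] [CommRing A] [Algebra k A]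
    [AddCommGroup M] [Module k M] [AddCommGroup N] [Module k N] [Module A N]
    [AddCommGroup T] [Module k T] (I : Ideal A) (e : T ≃ₗ[k] TensorProduct k M N) (j : ℕ) :
    Submodule k T :=
  Submodule.span k {t | ∃ (m : M) (x : N), x ∈ (I ^ j • ⊤ : Submodule A N) ∧
    t = e.symm (m ⊗ₜ[k] x)}

theorem radIdeal_isNilpotent (k : Type*) [Field k] (n p : ℕ) :
    IsNilpotent (radIdeal k n p) := by
  have hfg : (radIdeal k n p).FG := Submodule.fg_span (Set.finite_range _)
  rw [hfg.isNilpotent_iff_le_nilradical, radIdeal, Ideal.span_le]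
  rintro _ ⟨i, rfl⟩
  refine ⟨p, ?_⟩
  rw [Submodule.zero_eq_bot, Ideal.mem_bot, xGen, ← map_pow, Ideal.Quotient.eq_zero_iff_mem]
  exact Ideal.subset_span ⟨i, rfl⟩

section

variable {k : Type*} [Field k] {n p : ℕ} {M N T : Type*}
  [AddCommGroup M] [Module k M] [Module (TruncAlg k n p) M]
  [AddCommGroup N] [Module k N] [Module (TruncAlg k n p) N]
  [AddCommGroup T] [Module k T] [Module (TruncAlg k n p) T] [IsScalarTower k (TruncAlg k n p) T]
  {e : T ≃ₗ[k] TensorProduct k M N}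

theorem xGen_smul_mem_tensorFiltration
    (he : ∀ (i : Fin n) (m : M) (x : N),
      e (xGen k n p i • e.symm (m ⊗ₜ[k] x)) =
        (xGen k n p i • m) ⊗ₜ[k] x + m ⊗ₜ[k] (xGen k n p i • x))
    (i : Fin n) (j : ℕ) {t : T} (ht : t ∈ tensorFiltration k (radIdeal k n p) e j) :
    xGen k n p i • t ∈ tensorFiltration k (radIdeal k n p) e j := by
  induction ht using Submodule.span_induction with
  | mem t h =>
    obtain ⟨m, x, hx, rfl⟩ := h
    rw [← e.symm_apply_apply (xGen k n p i • e.symm (m ⊗ₜ[k] x)), he, map_add]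
    exact add_mem (Submodule.subset_span ⟨_, _, hx, rfl⟩)
      (Submodule.subset_span ⟨_, _, Submodule.smul_mem _ _ hx, rfl⟩)
  | zero => simp
  | add s t _ _ hs ht => rw [smul_add]; exact add_mem hs ht
  | smul c t _ ht =>
    rw [smul_comm]
    exact Submodule.smul_mem _ c ht

/-- On the graded pieces of the filtration, `A` acts through the first tensor factor. -/
theorem smul_tmul_sub_mem_tensorFiltration [IsScalarTower k (TruncAlg k n p) M]
    (he : ∀ (i : Fin n) (m : M) (x : N),
      e (xGen k n p i • e.symm (m ⊗ₜ[k] x)) =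
        (xGen k n p i • m) ⊗ₜ[k] x + m ⊗ₜ[k] (xGen k n p i • x))
    (a : TruncAlg k n p) (j : ℕ) (m : M) {x : N}
    (hx : x ∈ (radIdeal k n p ^ j • ⊤ : Submodule (TruncAlg k n p) N)) :
    a • e.symm (m ⊗ₜ[k] x) - e.symm ((a • m) ⊗ₜ[k] x) ∈
      tensorFiltration k (radIdeal k n p) e (j + 1) := by
  obtain ⟨f, rfl⟩ := Ideal.Quotient.mk_surjective a
  induction f using MvPolynomial.induction_on with
  | C c =>
    have hc : Ideal.Quotient.mk (truncIdeal k n p) (MvPolynomial.C c) =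
      algebraMap k (TruncAlg k n p) c := rfl
    rw [hc, algebraMap_smul, algebraMap_smul, ← TensorProduct.smul_tmul', map_smul, sub_self]
    exact zero_mem _
  | add f g hf hg =>
    have := add_mem hf hg
    simp only [map_add, add_smul, TensorProduct.add_tmul]
    convert this using 1
    abel
  | mul_X f i hf =>
    have hX : Ideal.Quotient.mk (truncIdeal k n p) (MvPolynomial.X i) = xGen k n p i := rfl
    rw [map_mul, hX, mul_comm]
    set a := Ideal.Quotient.mk (truncIdeal k n p) f
    have h1 := xGen_smul_mem_tensorFiltration he i (j + 1) hf
    have h2 : e.symm ((a • m) ⊗ₜ[k] (xGen k n p i • x)) ∈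
        tensorFiltration k (radIdeal k n p) e (j + 1) := by
      refine Submodule.subset_span ⟨_, _, ?_, rfl⟩
      rw [pow_succ', Submodule.mul_smul]
      exact Submodule.smul_mem_smul (Ideal.subset_span ⟨i, rfl⟩) hx
    have h3 : xGen k n p i • e.symm ((a • m) ⊗ₜ[k] x) =
        e.symm ((xGen k n p i • a • m) ⊗ₜ[k] x) +
          e.symm ((a • m) ⊗ₜ[k] (xGen k n p i • x)) := by
      rw [← map_add, ← he, e.symm_apply_apply]
    have h4 := add_mem h1 h2
    rw [smul_sub, h3] at h4
    rw [mul_smul, mul_smul]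
    convert h4 using 1
    abel

theorem isFreeVia_tensor_of_left [IsScalarTower k (TruncAlg k n p) M]
    [FiniteDimensional k M] [FiniteDimensional k N]
    {C : Type*} [CommRing C] [Algebra k C]
    (he : ∀ (i : Fin n) (m : M) (x : N),
      e (xGen k n p i • e.symm (m ⊗ₜ[k] x)) =
        (xGen k n p i • m) ⊗ₜ[k] x + m ⊗ₜ[k] (xGen k n p i • x))
    (α : C →ₐ[k] TruncAlg k n p) (hM : IsFreeVia α.toRingHom M) :
    IsFreeVia α.toRingHom T := by
  unfold IsFreeVia at hM ⊢
  let _ : Module C M := Module.compHom M α.toRingHom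
  let _ : Module C T := Module.compHom T α.toRingHom
  have smulM (c : C) (m : M) : c • m = α c • m := rfl
  have smulT (c : C) (t : T) : c • t = α c • t := rfl
  have : IsScalarTower k C M := ⟨fun a c m => by
    rw [smulM, smulM, map_smul, smul_assoc]⟩
  have : IsScalarTower k C T := ⟨fun a c m => by
    rw [smulT, smulT, map_smul, smul_assoc]⟩
  have : Module.Free C M := hM
  let b := Module.Free.chooseBasis C M
  let d := Module.Free.chooseBasis k N
  let v (q : Module.Free.ChooseBasisIndex C M × Module.Free.ChooseBasisIndex k N) : T :=
    e.symm (b q.1 ⊗ₜ[k] d q.2)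
  let S : Submodule C T := Submodule.span C (Set.range v)
  have hbS (i) (x : N) : e.symm (b i ⊗ₜ[k] x) ∈ S := by
    have hx : x ∈ Submodule.span k (Set.range d) := by rw [d.span_eq]; trivial
    induction hx using Submodule.span_induction with
    | mem x h => obtain ⟨j, rfl⟩ := h; exact Submodule.subset_span ⟨(i, j), rfl⟩
    | zero => simp
    | add x y _ _ hx hy => rw [TensorProduct.tmul_add, map_add]; exact add_mem hx hy
    | smul c x _ hx =>
      rw [TensorProduct.tmul_smul, map_smul]
      exact Submodule.smul_of_tower_mem S c hx
  obtain ⟨L, hL⟩ := radIdeal_isNilpotent k n p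
  have hstep (j : ℕ) (hj : tensorFiltration k (radIdeal k n p) e (j + 1) ≤ S.restrictScalars k) :
      tensorFiltration k (radIdeal k n p) e j ≤ S.restrictScalars k := by
    refine Submodule.span_le.2 ?_
    rintro _ ⟨m, x, hx, rfl⟩
    rw [SetLike.mem_coe, Submodule.restrictScalars_mem]
    have hm : m ∈ Submodule.span C (Set.range b) := by rw [b.span_eq]; trivial
    induction hm using Submodule.span_induction with
    | mem m h => obtain ⟨i, rfl⟩ := h; exact hbS i x
    | zero => simp
    | add m m' _ _ hm hm' => rw [TensorProduct.add_tmul, map_add]; exact add_mem hm hm'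
    | smul c m _ hm =>
      have h := hj (smul_tmul_sub_mem_tensorFiltration he (α c) j m hx)
      exact (Submodule.sub_mem_iff_right S (S.smul_mem c hm)).1 h
  have hall (j : ℕ) : tensorFiltration k (radIdeal k n p) e (L - j) ≤ S.restrictScalars k := by
    induction j with
    | zero =>
      refine Submodule.span_le.2 ?_
      rintro _ ⟨m, x, hx, rfl⟩
      rw [Nat.sub_zero, hL, Submodule.zero_eq_bot, Submodule.bot_smul, Submodule.mem_bot] at hx
      simp [hx]
    | succ j ih =>
      by_cases h : j < L
      · refine hstep _ ?_
        rwa [show L - (j + 1) + 1 = L - j by omega]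
      · rwa [show L - (j + 1) = L - j by omega]
  have hS : S = ⊤ := by
    refine eq_top_iff.2 fun t _ => ?_
    rw [← e.symm_apply_apply t]
    induction e t using TensorProduct.induction_on with
    | zero => simp
    | add s t hs ht => rw [map_add]; exact add_mem hs ht
    | tmul m x =>
      refine hall L (Submodule.subset_span ⟨m, x, ?_, rfl⟩)
      simp
  have hsurj : Function.Surjective (Finsupp.linearCombination C v) := by
    rw [← LinearMap.range_eq_top, Finsupp.range_linearCombination]
    exact hS
  let θ : T ≃ₗ[k]
      (Module.Free.ChooseBasisIndex C M × Module.Free.ChooseBasisIndex k N →₀ C) :=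
    e ≪≫ₗ TensorProduct.congr (b.repr.restrictScalars k) d.repr ≪≫ₗ
      finsuppTensorFinsupp k k C k _ _ ≪≫ₗ
      Finsupp.mapRange.linearEquiv (TensorProduct.rid k C)
  have : FiniteDimensional k T := Module.Finite.equiv e.symm
  let φ : T →ₗ[k] T := (Finsupp.linearCombination C v).restrictScalars k ∘ₗ θ.toLinearMap
  have hφ : Function.Injective φ :=
    LinearMap.injective_iff_surjective.2 (hsurj.comp θ.surjective)
  have hinj : Function.Injective (Finsupp.linearCombination C v) := by
    have h : Function.Injective (Finsupp.linearCombination C v ∘ θ) := hφ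
    exact (Function.Injective.of_comp_iff' _ θ.bijective).1 h
  exact Module.Free.of_equiv (LinearEquiv.ofBijective _ ⟨hinj, hsurj⟩)

end

/-- Let `T` be the `A`-module whose underlying space is `M ⊗_k N`, with each generator
`xᵢ` acting by `xᵢ·(m ⊗ n) = (xᵢ·m) ⊗ n + m ⊗ (xᵢ·n)`. If `α_U^*(T)` is not free over
`C`, then neither `α_U^*(M)` nor `α_U^*(N)` is free over `C`. -/
theorem statement6 {k : Type*} [Field k] [IsAlgClosed k] (p n r : ℕ) [Fact p.Prime]
    [CharP k p]
    (V : Submodule k (TruncAlg k n p))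
    (hV1 : V ⊓ Submodule.restrictScalars k ((radIdeal k n p) ^ 2 : Ideal (TruncAlg k n p)) = ⊥)
    (hV2 : V ⊔ Submodule.restrictScalars k ((radIdeal k n p) ^ 2 : Ideal (TruncAlg k n p)) =
      Submodule.restrictScalars k (radIdeal k n p))
    (M N : Type*)
    [AddCommGroup M] [Module k M] [Module (TruncAlg k n p) M]
    [IsScalarTower k (TruncAlg k n p) M] [FiniteDimensional k M]
    [AddCommGroup N] [Module k N] [Module (TruncAlg k n p) N]
    [IsScalarTower k (TruncAlg k n p) N] [FiniteDimensional k N]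
    (T : Type*) [AddCommGroup T] [Module k T] [Module (TruncAlg k n p) T]
    [IsScalarTower k (TruncAlg k n p) T]
    (e : T ≃ₗ[k] TensorProduct k M N)
    (he : ∀ (i : Fin n) (m : M) (x : N),
      e (xGen k n p i • e.symm (m ⊗ₜ[k] x)) =
        (xGen k n p i • m) ⊗ₜ[k] x + m ⊗ₜ[k] (xGen k n p i • x))
    (u : Fin r → TruncAlg k n p) (hu : ∀ i, u i ∈ V) (hind : LinearIndependent k u)
    (α : TruncAlg k r p →ₐ[k] TruncAlg k n p) (hα : ∀ i, α (xGen k r p i) = u i)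
    (hT : ¬ IsFreeVia α.toRingHom T) :
    ¬ IsFreeVia α.toRingHom M ∧ ¬ IsFreeVia α.toRingHom N := by
  refine ⟨fun hM => hT (isFreeVia_tensor_of_left he α hM), fun hN => hT ?_⟩
  refine isFreeVia_tensor_of_left (e := e ≪≫ₗ TensorProduct.comm k M N) (fun i x m => ?_) α hN
  simp [he, add_comm]

end
end
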